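/- Fix n ≥ 2 and let Q ⊆ R be such that the action of t strictly confines R into Q. Let f₁, …, f_m be a finite collection of elements of B₊ \ Q. Let P = {t^i f_j : 1 ≤ j ≤ m, i ≥ 0} and Q̄ = Q ∪ P. Then: (1) the action of t strictly confines R into Q̄; and (2) there exists N ∈ ℕ such that, in the lamplighter group L_n, every element of Q̄ is a product of at most N elements of S ∪ S⁻¹, where S = Q ∪ {t, t⁻¹}. -/

import Mathlib

open Function Set Pointwise

/-- The base `A = ⊕_{i∈ℤ} ℤ_n` of the lamplighter group, identified with the additive
group of the Laurent polynomial ring `R = ℤ_n[t, t⁻¹]` (a Laurent polynomial is its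
finitely supported coefficient function `ℤ →₀ ℤ_n`). -/
abbrev Rn (n : ℕ) := ℤ →₀ ZMod n

/-- Multiplication by `t^m` on `R = ℤ_n[t, t⁻¹]`: the coefficient of `t^j` in `t^m·p`
is the coefficient of `t^{j−m}` in `p`. -/
def tmul (n : ℕ) (m : ℤ) : Rn n ≃+ Rn n :=
  Finsupp.domCongr (Equiv.addRight m)

/-- `B₊`: the set of Laurent polynomials all of whose exponents are `≥ 0`. -/
def Bplus (n : ℕ) : Set (Rn n) := {p | ∀ i : ℤ, i < 0 → p i = 0}

/-- The action of `t` confines `R` into `Q`: (a) `tQ ⊆ Q`; (b) every `p ∈ R` has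
`t^m p ∈ Q` for some `m ≥ 0`; (c) `t^{n₀}(Q + Q) ⊆ Q` for some `n₀ ≥ 0`. -/
def ConfinesT (n : ℕ) (Q : Set (Rn n)) : Prop :=
  (∀ q ∈ Q, tmul n 1 q ∈ Q) ∧
  (∀ p : Rn n, ∃ m : ℕ, tmul n m p ∈ Q) ∧
  (∃ n₀ : ℕ, ∀ q₁ ∈ Q, ∀ q₂ ∈ Q, tmul n n₀ (q₁ + q₂) ∈ Q)

/-- Strictly confining: moreover `tQ` is a proper subset of `Q`. -/
def StrictlyConfinesT (n : ℕ) (Q : Set (Rn n)) : Prop :=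
  ConfinesT n Q ∧ ⇑(tmul n 1) '' Q ⊂ Q

/-- The lamplighter group `L_n = ℤ_n wr ℤ = (⊕_{ℤ} ℤ_n) ⋊ ℤ`, where the generator `t`
of `ℤ` acts on the base by the shift (= multiplication by `t`). -/
abbrev Ln (n : ℕ) := SemidirectProduct (Multiplicative (Rn n)) (Multiplicative ℤ)
  (zpowersHom (MulAut (Multiplicative (Rn n))) (AddEquiv.toMultiplicative (tmul n 1)))

/-- The element `t` of the lamplighter group. -/
noncomputable def tL (n : ℕ) : Ln n := SemidirectProduct.inr (Multiplicative.ofAdd (1 : ℤ))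

/-- The embedding of the base `A = R` into the lamplighter group. -/
noncomputable def ι (n : ℕ) (p : Rn n) : Ln n := SemidirectProduct.inl (Multiplicative.ofAdd p)

/-- the generating set `S = Q ∪ {t, t⁻¹}` of `L_n` associated with `Q ⊆ R`. -/
def Sgen (n : ℕ) (Q : Set (Rn n)) : Set (Ln n) :=
  (ι n '' Q) ∪ {tL n, (tL n)⁻¹}

/-- products of at most `N` elements of `S ∪ S⁻¹`. -/
def wordBall {W : Type*} [Group W] (S : Set W) (N : ℕ) : Set W :=
  {w | ∃ l : List W, l.length ≤ N ∧ (∀ x ∈ l, x ∈ S ∪ S⁻¹) ∧ l.prod = w}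

theorem tmul_add' (n : ℕ) (a b : ℤ) (p : Rn n) : tmul n a (tmul n b p) = tmul n (a + b) p := by
  ext i
  simp only [tmul, Finsupp.domCongr_apply, Finsupp.equivMapDomain_apply]
  congr 1
  simp only [Equiv.addRight_symm, Equiv.coe_addRight]
  ring

theorem tmul_zero' (n : ℕ) (p : Rn n) : tmul n 0 p = p := by
  ext i
  simp only [tmul, Finsupp.domCongr_apply, Finsupp.equivMapDomain_apply, Equiv.addRight_symm,
    Equiv.coe_addRight, neg_zero, add_zero]

theorem iota_conj (n : ℕ) (p : Rn n) : ι n (tmul n 1 p) = tL n * ι n p * (tL n)⁻¹ := by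
  have h := SemidirectProduct.inl_aut
    (φ := zpowersHom (MulAut (Multiplicative (Rn n))) (AddEquiv.toMultiplicative (tmul n 1)))
    (Multiplicative.ofAdd (1 : ℤ)) (Multiplicative.ofAdd p)
  simpa [ι, tL] using h

theorem iota_conj_pow (n : ℕ) (k : ℕ) (p : Rn n) :
    ι n (tmul n k p) = tL n ^ k * ι n p * ((tL n)⁻¹) ^ k := by
  induction k with
  | zero => simp [tmul_zero']
  | succ k ih =>
    have : tmul n ((k + 1 : ℕ) : ℤ) p = tmul n 1 (tmul n k p) := by
      rw [tmul_add']; congr 2; push_cast; ring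
    rw [this, iota_conj, ih, pow_succ' (tL n), pow_succ (tL n)⁻¹]
    group

theorem tmul_mem_nat (n : ℕ) (Q : Set (Rn n)) (h : ∀ q ∈ Q, tmul n 1 q ∈ Q) (k : ℕ)
    (q : Rn n) (hq : q ∈ Q) : tmul n k q ∈ Q := by
  induction k with
  | zero => simpa [tmul_zero'] using hq
  | succ k ih =>
    have : tmul n ((k + 1 : ℕ) : ℤ) q = tmul n 1 (tmul n k q) := by
      rw [tmul_add']; congr 2; push_cast; ring
    rw [this]
    exact h _ ih

/-- If `t` strictly confines `R` into `Q` and `f₁, …, f_m` is a finite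
collection of elements of `B₊ \ Q`, then with `P = {t^i f_j}` and `Q̄ = Q ∪ P`:
(1) `t` strictly confines `R` into `Q̄`; (2) `Q̄` is uniformly bounded in the word metric
on `L_n` given by `S = Q ∪ {t, t⁻¹}`. -/
theorem enlarge_confining_by_finite_family (n : ℕ) (hn : 2 ≤ n) (Q : Set (Rn n))
    (hQ : StrictlyConfinesT n Q) (m : ℕ) (f : Fin m → Rn n)
    (hf : ∀ j, f j ∈ Bplus n \ Q) :
    StrictlyConfinesT n (Q ∪ {p | ∃ (j : Fin m) (i : ℕ), p = tmul n (i : ℤ) (f j)}) ∧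
    ∃ N : ℕ, ∀ p ∈ Q ∪ {p | ∃ (j : Fin m) (i : ℕ), p = tmul n (i : ℤ) (f j)},
      ι n p ∈ wordBall (Sgen n Q) N := by
  obtain ⟨⟨ha, hb, n₀, hc⟩, hs⟩ := hQ
  set Q' : Set (Rn n) := Q ∪ {p | ∃ (j : Fin m) (i : ℕ), p = tmul n (i : ℤ) (f j)} with hQ'
  have hsub : Q ⊆ Q' := subset_union_left
  have ha' : ∀ q ∈ Q', tmul n 1 q ∈ Q' := by
    rintro q (hq | ⟨j, i, rfl⟩)
    · exact Or.inl (ha q hq)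
    · refine Or.inr ⟨j, i + 1, ?_⟩
      rw [tmul_add']; congr 2; push_cast; ring
  choose e he using fun j => hb (f j)
  obtain ⟨k, hk⟩ : ∃ k : ℕ, ∀ q ∈ Q', tmul n k q ∈ Q := by
    refine ⟨∑ j, e j, ?_⟩
    rintro q (hq | ⟨j, i, rfl⟩)
    · exact tmul_mem_nat n Q ha _ q hq
    · have hle : e j ≤ ∑ j, e j := Finset.single_le_sum (fun _ _ => Nat.zero_le _) (Finset.mem_univ j)
      obtain ⟨d, hd⟩ := Nat.exists_eq_add_of_le hle
      have := tmul_mem_nat n Q ha (d + i) _ (he j)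
      rw [tmul_add'] at this ⊢
      convert this using 3
      rw [hd]; push_cast; ring
  refine ⟨⟨⟨ha', fun p => ?_, n₀ + (k + 0), fun p hp q hq => ?_⟩, ?_⟩, 2 * k + 1, fun p hp => ?_⟩
  · obtain ⟨l, hl⟩ := hb p
    exact ⟨l, hsub hl⟩
  · have := hc _ (hk p hp) _ (hk q hq)
    rw [← map_add, tmul_add'] at this
    apply hsub
    convert this using 3
    push_cast; ring
  · have h1 : ⇑(tmul n 1) '' Q' ⊆ Q' := by
      rintro _ ⟨q, hq, rfl⟩
      exact ha' q hq
    refine ⟨h1, fun h2 => hs.2 ?_⟩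
    have h3 : ∀ l : ℕ, ∀ q ∈ Q', ∃ r ∈ Q', q = tmul n l r := by
      intro l
      induction l with
      | zero => exact fun q hq => ⟨q, hq, by simp [tmul_zero']⟩
      | succ l ih =>
        intro q hq
        obtain ⟨r, hr, rfl⟩ := ih q hq
        obtain ⟨s, hs', rfl⟩ := h2 hr
        refine ⟨s, hs', ?_⟩
        rw [tmul_add']; push_cast; rfl
    have h4 : Q' ⊆ Q := by
      intro q hq
      obtain ⟨r, hr, rfl⟩ := h3 k q hq
      exact hk r hr
    have h5 : Q' = Q := h4.antisymm hsub
    rwa [h5] at h2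
  · refine ⟨List.replicate k (tL n)⁻¹ ++ (ι n (tmul n k p) :: List.replicate k (tL n)), ?_, ?_, ?_⟩
    · simp; omega
    · intro x hx
      simp only [List.mem_append, List.mem_cons, List.mem_replicate] at hx
      left
      rcases hx with ⟨_, rfl⟩ | rfl | ⟨_, rfl⟩
      · right; simp
      · left; exact ⟨_, hk p hp, rfl⟩
      · right; simp
    · simp only [List.prod_append, List.prod_cons, List.prod_replicate, iota_conj_pow]
      group
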